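/- Let φ and ϕ be complex numbers of unit norm and Q = Q(A,G,φ,ϕ). Then Q ψ_a = ϕ·((1−φ)·a − 1)·ψ_a + ϕ·(1−φ)·a·ψ_b and Q ψ_b = (1−φ)·(1−a)·ψ_a − ((1−φ)·a + φ)·ψ_b, where a = ‖ψ_a‖². In particular the subspace spanned by ψ_a and ψ_b is invariant under Q. -/

import Mathlib

open scoped InnerProductSpace

/-- The phase-shift operator `S_K^φ = id − (1−φ)·(orthogonal projection onto K)`. -/
noncomputable def Sop {E : Type*} [NormedAddCommGroup E] [InnerProductSpace ℂ E]
    [FiniteDimensional ℂ E] (K : Submodule ℂ E) (φ : ℂ) (x : E) : E :=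
  x - (1 - φ) • (Submodule.orthogonalProjectionOnto K x : E)

/-- The amplitude amplification operator `Q(A,G,φ,ϕ) = −A ∘ S₀^φ ∘ A⁻¹ ∘ S_G^ϕ`. -/
noncomputable def ampQ {E : Type*} [NormedAddCommGroup E] [InnerProductSpace ℂ E]
    [FiniteDimensional ℂ E] (A : E ≃ₗᵢ[ℂ] E) (e₀ : E) (G : Submodule ℂ E)
    (φ ϕ : ℂ) (x : E) : E :=
  - A (Sop (ℂ ∙ e₀) φ (A.symm (Sop G ϕ x)))

section ampQ

variable {E : Type*} [NormedAddCommGroup E] [InnerProductSpace ℂ E] [FiniteDimensional ℂ E]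

/-- `-A ∘ S₀^φ ∘ A⁻¹` is minus a phase shift along the line spanned by `A e₀`. -/
theorem ampQ_eq_inner_smul_sub (A : E ≃ₗᵢ[ℂ] E) {e₀ : E} (he₀ : ‖e₀‖ = 1) (G : Submodule ℂ E)
    (φ ϕ : ℂ) (x : E) :
    ampQ A e₀ G φ ϕ x = ((1 - φ) * ⟪A e₀, Sop G ϕ x⟫_ℂ) • A e₀ - Sop G ϕ x := by
  have hinner : ⟪e₀, A.symm (Sop G ϕ x)⟫_ℂ = ⟪A e₀, Sop G ϕ x⟫_ℂ := by
    rw [← A.inner_map_map, A.apply_symm_apply]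
  have hproj (y : E) : (Submodule.orthogonalProjectionOnto (ℂ ∙ e₀) y : E) = ⟪e₀, y⟫_ℂ • e₀ := by
    rw [← Submodule.starProjection_apply, Submodule.starProjection_unit_singleton ℂ he₀]
  unfold ampQ
  rw [Sop, hproj, hinner, map_sub, A.apply_symm_apply, map_smul, map_smul, smul_smul, neg_sub]

theorem ampQ_add (A : E ≃ₗᵢ[ℂ] E) (e₀ : E) (G : Submodule ℂ E) (φ ϕ : ℂ) (x y : E) :
    ampQ A e₀ G φ ϕ (x + y) = ampQ A e₀ G φ ϕ x + ampQ A e₀ G φ ϕ y := by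
  have hS (K : Submodule ℂ E) (c : ℂ) (u v : E) : Sop K c (u + v) = Sop K c u + Sop K c v := by
    simp only [Sop, map_add, Submodule.coe_add]
    module
  simp only [ampQ, hS, map_add, neg_add]

theorem ampQ_smul (A : E ≃ₗᵢ[ℂ] E) (e₀ : E) (G : Submodule ℂ E) (φ ϕ c : ℂ) (x : E) :
    ampQ A e₀ G φ ϕ (c • x) = c • ampQ A e₀ G φ ϕ x := by
  have hS (K : Submodule ℂ E) (d : ℂ) (u : E) : Sop K d (c • u) = c • Sop K d u := by
    simp only [Sop, map_smul, Submodule.coe_smul]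
    module
  simp only [ampQ, hS, map_smul, smul_neg]

theorem Sop_of_mem {K : Submodule ℂ E} {x : E} (hx : x ∈ K) (φ : ℂ) : Sop K φ x = φ • x := by
  rw [Sop, ← Submodule.starProjection_apply, Submodule.starProjection_eq_self_iff.mpr hx]
  module

theorem Sop_of_mem_orthogonal {K : Submodule ℂ E} {x : E} (hx : x ∈ Kᗮ) (φ : ℂ) :
    Sop K φ x = x := by
  simp [Sop, Submodule.orthogonalProjectionOnto_apply_of_mem_orthogonal hx]

end ampQ

/-- `Q ψ_a = ϕ((1−φ)a − 1)·ψ_a + ϕ(1−φ)a·ψ_b` and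
`Q ψ_b = (1−φ)(1−a)·ψ_a − ((1−φ)a + φ)·ψ_b`, where `a = ‖ψ_a‖²`; in particular the
subspace spanned by `ψ_a` and `ψ_b` is invariant under `Q`. -/
theorem stmt2 {E : Type*} [NormedAddCommGroup E] [InnerProductSpace ℂ E]
    [FiniteDimensional ℂ E]
    (A : E ≃ₗᵢ[ℂ] E) (e₀ : E) (he₀ : ‖e₀‖ = 1) (G : Submodule ℂ E)
    (φ ϕ : ℂ) (hφ : ‖φ‖ = 1) (hϕ : ‖ϕ‖ = 1)
    (ψ ψa ψb : E) (a : ℝ)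
    (hψ : ψ = A e₀) (hψa : ψa = (Submodule.orthogonalProjectionOnto G ψ : E)) (hψb : ψb = ψ - ψa)
    (ha : a = ‖ψa‖ ^ 2) :
    ampQ A e₀ G φ ϕ ψa
        = (ϕ * ((1 - φ) * (a : ℂ) - 1)) • ψa + (ϕ * (1 - φ) * (a : ℂ)) • ψb ∧
    ampQ A e₀ G φ ϕ ψb
        = ((1 - φ) * (1 - (a : ℂ))) • ψa - ((1 - φ) * (a : ℂ) + φ) • ψb ∧
    ∀ x ∈ Submodule.span ℂ {ψa, ψb}, ampQ A e₀ G φ ϕ x ∈ Submodule.span ℂ {ψa, ψb} := by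
  have haG : ψa ∈ G := hψa ▸ Submodule.coe_mem _
  have hbG : ψb ∈ Gᗮ := by
    rw [hψb, hψa]
    exact Submodule.sub_starProjection_mem_orthogonal ψ
  have hsum : ψ = ψa + ψb := by rw [hψb, add_sub_cancel]
  have hψ_norm : ⟪ψ, ψ⟫_ℂ = 1 := by
    rw [inner_self_eq_norm_sq_to_K, hψ, A.norm_map, he₀]
    simp
  have hψψa : ⟪ψ, ψa⟫_ℂ = a := by
    rw [hsum, inner_add_left, Submodule.inner_left_of_mem_orthogonal haG hbG,
      inner_self_eq_norm_sq_to_K, ha]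
    simp
  have hψψb : ⟪ψ, ψb⟫_ℂ = 1 - a := by rw [hψb, inner_sub_right, hψ_norm, hψψa]
  have hQa : ampQ A e₀ G φ ϕ ψa
      = (ϕ * ((1 - φ) * (a : ℂ) - 1)) • ψa + (ϕ * (1 - φ) * (a : ℂ)) • ψb := by
    rw [ampQ_eq_inner_smul_sub A he₀, ← hψ, Sop_of_mem haG, inner_smul_right, hψψa, hsum]
    module
  have hQb : ampQ A e₀ G φ ϕ ψb
      = ((1 - φ) * (1 - (a : ℂ))) • ψa - ((1 - φ) * (a : ℂ) + φ) • ψb := by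
    rw [ampQ_eq_inner_smul_sub A he₀, ← hψ, Sop_of_mem_orthogonal hbG, hψψb, hsum]
    module
  refine ⟨hQa, hQb, fun x hx ↦ ?_⟩
  obtain ⟨c, d, rfl⟩ := Submodule.mem_span_pair.mp hx
  rw [ampQ_add, ampQ_smul, ampQ_smul, hQa, hQb, Submodule.mem_span_pair]
  exact ⟨c * (ϕ * ((1 - φ) * a - 1)) + d * ((1 - φ) * (1 - a)),
    c * (ϕ * (1 - φ) * a) - d * ((1 - φ) * a + φ), by module⟩
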